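/- For all integers n ≥ 5 and 5 ≤ k ≤ n, one has g_n(1k) = (1+q)·g_n(1(k-1)) − q·g_n(1(k-2)) − (1−q)·g_{n-1}(1(k-1)) in ℤ[q]. -/

import Mathlib

open Finset Polynomial

/-- The cycle of `π` starting at `m`: `m, π m, π² m, …` through one full period. -/
noncomputable def cycleList {n : ℕ} (π : Equiv.Perm (Fin n)) (m : Fin n) : List (Fin n) :=
  (List.range (Function.minimalPeriod π m)).map (fun k => (π ^ k) m)

/-- The minima of the cycles of `π`, listed in increasing order. -/
def cycleMins {n : ℕ} (π : Equiv.Perm (Fin n)) : List (Fin n) :=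
  (Finset.univ.filter (fun m : Fin n => ∀ k < n, m ≤ (π ^ k) m)).sort (· ≤ ·)

/-- The flattened permutation of `π`, as a word on the letters `1, …, n`:
erase the parentheses from the standard cycle form of `π`. -/
noncomputable def flattenPerm {n : ℕ} (π : Equiv.Perm (Fin n)) : List ℕ :=
  ((cycleMins π).map (cycleList π)).flatten.map (fun m => (m : ℕ) + 1)

/-- The number of occurrences of the pattern 13-2 in the word `w = w₁w₂⋯wₙ`
(1-based), i.e. the number of pairs `(i,j)` with `2 ≤ i < j ≤ n` and
`w_{i-1} < w_j < w_i`.  Below, `p.1` and `p.2` are the 0-based versions of `i` and `j`. -/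
def occ (w : List ℕ) : ℕ :=
  ((Finset.range w.length ×ˢ Finset.range w.length).filter
    (fun p : ℕ × ℕ => 1 ≤ p.1 ∧ p.1 < p.2 ∧
      w.getD (p.1 - 1) 0 < w.getD p.2 0 ∧ w.getD p.2 0 < w.getD p.1 0)).card

/-- `g_n = Σ_{π ∈ S_n} q^{occ(Flatten(π))} ∈ ℤ[q]`. -/
noncomputable def gPoly (n : ℕ) : Polynomial ℤ :=
  ∑ π : Equiv.Perm (Fin n), X ^ occ (flattenPerm π)

/-- `g_n(a₁⋯a_k)`: the sum of `q^{occ(Flatten(π))}` over the permutations `π` of length `n`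
whose flattened permutation starts with the subword `a₁⋯a_k`. -/
noncomputable def gPrefix (n : ℕ) (w : List ℕ) : Polynomial ℤ :=
  ∑ π ∈ Finset.univ.filter (fun π : Equiv.Perm (Fin n) => w <+: flattenPerm π),
    X ^ occ (flattenPerm π)

/-- `g_{n,r}(a₁⋯a_k)`: the number of permutations `π` of length `n` such that `Flatten(π)`
starts with `a₁⋯a_k` and has exactly `r` occurrences of the pattern 13-2. -/
noncomputable def gCount (n r : ℕ) (w : List ℕ) : ℕ :=
  (Finset.univ.filter (fun π : Equiv.Perm (Fin n) =>
    w <+: flattenPerm π ∧ occ (flattenPerm π) = r)).card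

/-- Words using each letter of `B` exactly once. -/
def lw (B : Finset ℕ) : Finset (List ℕ) := B.val.lists.toFinset

theorem mem_lw (B : Finset ℕ) (l : List ℕ) : l ∈ lw B ↔ l.Nodup ∧ l.toFinset = B := by
  unfold lw
  rw [Multiset.mem_toFinset, Multiset.mem_lists_iff]
  constructor
  · intro h
    have hn : l.Nodup := by
      have := B.nodup
      rw [h] at this
      simpa using this
    refine ⟨hn, ?_⟩
    ext x
    rw [List.mem_toFinset, ← Finset.mem_val, h]
    simp
  · rintro ⟨h1, rfl⟩
    rw [List.toFinset_val, h1.dedup]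
    rfl

theorem lw_empty : lw ∅ = {[]} := by
  ext l
  rw [mem_lw]
  simp only [List.toFinset_eq_empty_iff, Finset.mem_singleton]
  constructor
  · rintro ⟨_, h⟩; exact h
  · rintro rfl; simp

theorem lw_sum {M : Type*} [AddCommMonoid M] (B : Finset ℕ) (hB : B.Nonempty) (f : List ℕ → M) :
    ∑ w ∈ lw B, f w = ∑ a ∈ B, ∑ l ∈ lw (B.erase a), f (a :: l) := by
  rw [Finset.sum_sigma']
  symm
  refine Finset.sum_bij (fun p _ => p.1 :: p.2) ?_ ?_ ?_ ?_
  · rintro ⟨a, l⟩ h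
    simp only [Finset.mem_sigma, mem_lw] at h ⊢
    obtain ⟨ha, hl, hB⟩ := h
    have : a ∉ l := by
      rw [← List.mem_toFinset, hB]; simp
    refine ⟨List.nodup_cons.2 ⟨this, hl⟩, ?_⟩
    rw [List.toFinset_cons, hB, Finset.insert_erase ha]
  · rintro ⟨a, l⟩ _ ⟨a', l'⟩ _ h
    simp only [List.cons.injEq] at h
    obtain ⟨rfl, rfl⟩ := h
    rfl
  · intro w hw
    rw [mem_lw] at hw
    obtain ⟨h1, h2⟩ := hw
    cases w with
    | nil => simp at h2; subst h2; simp at hB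
    | cons a l =>
      refine ⟨⟨a, l⟩, ?_, rfl⟩
      rw [List.nodup_cons] at h1
      simp only [Finset.mem_sigma, mem_lw]
      subst h2
      refine ⟨by simp, h1.2, ?_⟩
      rw [List.toFinset_cons, Finset.erase_insert]
      simpa using h1.1
  · intros; rfl

/-- Right-to-left minima. -/
def rl : List ℕ → Finset ℕ
  | [] => ∅
  | a :: l => if ∀ b ∈ l, a < b then insert a (rl l) else rl l

theorem rl_subset (l : List ℕ) : rl l ⊆ l.toFinset := by
  induction l with
  | nil => simp [rl]
  | cons a l ih =>
    unfold rl
    split_ifs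
    · rw [List.toFinset_cons]; exact Finset.insert_subset_insert _ ih
    · rw [List.toFinset_cons]; exact ih.trans (Finset.subset_insert _ _)

theorem two_pow_rl {R : Type*} [CommSemiring R] (a : ℕ) (l : List ℕ) (h : a ∉ l) :
    (2 : R) ^ (rl (a :: l)).card = (if ∀ b ∈ l, a < b then 2 else 1) * 2 ^ (rl l).card := by
  have : a ∉ rl l := fun h' => h (by simpa using rl_subset l h')
  rw [rl]
  split_ifs
  · rw [Finset.card_insert_of_notMem this, pow_succ, mul_comm]
  · simp

theorem mem_rl (p s : List ℕ) (m : ℕ) (h : ∀ b ∈ s, m < b) : m ∈ rl (p ++ m :: s) := by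
  induction p with
  | nil => simp only [List.nil_append]; rw [rl, if_pos h]; simp
  | cons a p ih =>
    simp only [List.cons_append]
    rw [rl]
    split_ifs
    · exact Finset.mem_insert_of_mem ih
    · exact ih

theorem sum_min (B : Finset ℕ) (hB : B.Nonempty) :
    ∑ a ∈ B, (if ∀ b ∈ B.erase a, a < b then 2 else 1) = B.card + 1 := by
  have : ∀ a ∈ B, (if ∀ b ∈ B.erase a, a < b then 2 else 1) =
      (if B.min' hB = a then 1 else 0) + 1 := by
    intro a ha
    have : (∀ b ∈ B.erase a, a < b) ↔ B.min' hB = a := by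
      constructor
      · intro h
        by_contra hne
        have h1 := h (B.min' hB) (Finset.mem_erase.2 ⟨hne, Finset.min'_mem _ _⟩)
        have h2 := Finset.min'_le B a ha
        omega
      · rintro rfl b hb
        rw [Finset.mem_erase] at hb
        have h2 := Finset.min'_le B b hb.2
        omega
    simp only [this]
    split_ifs <;> rfl
  rw [Finset.sum_congr rfl this, Finset.sum_add_distrib, Finset.sum_ite_eq]
  simp [Finset.min'_mem, add_comm]

theorem lw_count (N : ℕ) : ∀ B : Finset ℕ, B.card = N →
    ∑ w ∈ lw B, 2 ^ (rl w).card = (N + 1).factorial := by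
  induction N with
  | zero =>
    intro B h
    rw [Finset.card_eq_zero] at h
    subst h
    rw [lw_empty]; simp [rl]
  | succ N ih =>
    intro B h
    have hB : B.Nonempty := Finset.card_pos.1 (by omega)
    rw [lw_sum B hB]
    have : ∀ a ∈ B, ∑ l ∈ lw (B.erase a), 2 ^ (rl (a :: l)).card =
        (if ∀ b ∈ B.erase a, a < b then 2 else 1) * (N + 1).factorial := by
      intro a ha
      rw [← ih (B.erase a) (by rw [Finset.card_erase_of_mem ha]; omega), Finset.mul_sum]
      refine Finset.sum_congr rfl ?_
      intro l hl
      rw [mem_lw] at hl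
      have hal : a ∉ l := by rw [← List.mem_toFinset, hl.2]; simp
      rw [two_pow_rl a l hal, ← hl.2]
      simp
    rw [Finset.sum_congr rfl this, ← Finset.sum_mul, sum_min B hB, h]
    rfl

theorem sum_getD (p : ℕ → Prop) [DecidablePred p] (l : List ℕ) :
    ∑ j ∈ range l.length, (if p (l.getD j 0) then 1 else 0) = (l.filter p).length := by
  induction l with
  | nil => simp
  | cons a l ih =>
    rw [List.length_cons, Finset.sum_range_succ']
    simp only [List.getD_cons_succ, List.getD_cons_zero, ih, List.filter_cons]
    by_cases h : p a <;> simp [h]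

theorem occ_cons_cons (a b : ℕ) (l : List ℕ) :
    occ (a :: b :: l) = (l.filter (fun c => a < c ∧ c < b)).length + occ (b :: l) := by
  rw [← sum_getD]
  unfold occ
  rw [Finset.card_filter, Finset.card_filter, Finset.sum_product, Finset.sum_product]
  simp only [List.length_cons]
  rw [Finset.sum_range_succ']
  have h0 : ∑ y ∈ range (l.length + 1 + 1), (if 1 ≤ (0, y).1 ∧ (0, y).1 < (0, y).2 ∧
      (a :: b :: l).getD ((0, y).1 - 1) 0 < (a :: b :: l).getD (0, y).2 0 ∧
      (a :: b :: l).getD (0, y).2 0 < (a :: b :: l).getD (0, y).1 0 then 1 else 0) = 0 := by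
    simp
  rw [h0, add_zero, Finset.sum_range_succ', add_comm]
  congr 1
  · rw [Finset.sum_range_succ', Finset.sum_range_succ']
    simp
  · symm
    rw [Finset.sum_range_succ']
    simp only [nonpos_iff_eq_zero, one_ne_zero, false_and, if_false, Finset.sum_const_zero, add_zero]
    refine Finset.sum_congr rfl fun i _ => ?_
    symm
    rw [Finset.sum_range_succ']
    simp

theorem occ_nil : occ [] = 0 := by simp [occ]
theorem occ_single (a : ℕ) : occ [a] = 0 := by
  simp [occ]

/-- rank -/
def rk (B : Finset ℕ) (a : ℕ) : ℕ := (B.filter (· < a)).card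

theorem sum_rk {M : Type*} [AddCommMonoid M] (f : ℕ → M) (B : Finset ℕ) :
    ∑ b ∈ B, f (rk B b) = ∑ i ∈ range B.card, f i := by
  induction B using Finset.induction_on_max with
  | empty => simp
  | insert a s h ih =>
    have ha : a ∉ s := fun h' => lt_irrefl _ (h a h')
    rw [Finset.sum_insert ha, Finset.card_insert_of_notMem ha, Finset.sum_range_succ, add_comm, ← ih]
    congr 1
    · refine Finset.sum_congr rfl fun b hb => ?_
      congr 1
      unfold rk
      congr 1
      rw [Finset.filter_insert, if_neg (not_lt.2 (h b hb).le)]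
    · congr 1
      unfold rk
      congr 1
      rw [Finset.filter_insert, if_neg (lt_irrefl _), Finset.filter_true_of_mem h]

theorem rk_erase (B : Finset ℕ) (a : ℕ) : rk (B.erase a) a = rk B a := by
  unfold rk
  congr 1
  ext x; simp only [Finset.mem_filter, Finset.mem_erase]; constructor
  · rintro ⟨⟨_, h⟩, h'⟩; exact ⟨h, h'⟩
  · rintro ⟨h, h'⟩; exact ⟨⟨by omega, h⟩, h'⟩

theorem rk_sub (B : Finset ℕ) (a b : ℕ) (ha : a ∉ B) :
    (B.filter (fun c => a < c ∧ c < b)).card = rk B b - rk B a := by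
  unfold rk
  rcases le_or_gt a b with h | h
  · have hs : B.filter (· < a) ⊆ B.filter (· < b) := by
      intro x; simp only [Finset.mem_filter]; rintro ⟨h1, h2⟩; exact ⟨h1, by omega⟩
    rw [← Finset.card_sdiff_of_subset hs]
    congr 1
    ext x; simp only [Finset.mem_filter, Finset.mem_sdiff]
    constructor
    · rintro ⟨h1, h2, h3⟩; exact ⟨⟨h1, h3⟩, by rintro ⟨_, h4⟩; omega⟩
    · rintro ⟨⟨h1, h2⟩, h3⟩
      have : x ≠ a := by rintro rfl; exact ha h1
      have : ¬ x < a := fun h4 => h3 ⟨h1, h4⟩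
      exact ⟨h1, by omega, h2⟩
  · have hs : B.filter (· < b) ⊆ B.filter (· < a) := by
      intro x; simp only [Finset.mem_filter]; rintro ⟨h1, h2⟩; exact ⟨h1, by omega⟩
    have := Finset.card_le_card hs
    rw [Nat.sub_eq_zero_of_le this, Finset.card_eq_zero, Finset.filter_eq_empty_iff]
    intro x _; omega

theorem rk_zero (B : Finset ℕ) (a : ℕ) : (∀ b ∈ B.erase a, a < b) ↔ rk B a = 0 := by
  unfold rk
  rw [Finset.card_eq_zero, Finset.filter_eq_empty_iff]
  constructor
  · intro h x hx hxa
    have := h x (Finset.mem_erase.2 ⟨by omega, hx⟩)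
    omega
  · intro h b hb
    rw [Finset.mem_erase] at hb
    have := h hb.2
    omega

/-- The weight of a word. -/
noncomputable def W (w : List ℕ) : Polynomial ℤ := 2 ^ (rl w).card * X ^ occ w

/-- The recursive version of the weighted count, by size and rank. -/
noncomputable def hh : ℕ → ℕ → Polynomial ℤ
  | 0, _ => 0
  | 1, _ => 2
  | m + 2, j => (if j = 0 then 2 else 1) * ∑ i ∈ range (m + 1), X ^ (i - j) * hh (m + 1) i

theorem sum_W (m : ℕ) : ∀ (B : Finset ℕ) (a : ℕ), B.card = m + 1 → a ∈ B →
    ∑ l ∈ lw (B.erase a), W (a :: l) = hh (m + 1) (rk B a) := by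
  induction m with
  | zero =>
    intro B a h ha
    have : B.erase a = ∅ := by
      rw [← Finset.card_eq_zero, Finset.card_erase_of_mem ha]; omega
    rw [this, lw_empty]
    simp [W, rl, hh, occ_single]
  | succ m ih =>
    intro B a h ha
    have hc : (B.erase a).card = m + 1 := by rw [Finset.card_erase_of_mem ha]; omega
    rw [lw_sum _ (Finset.card_pos.1 (by omega)), hh, ← hc, ← sum_rk, Finset.mul_sum]
    refine Finset.sum_congr rfl fun b hb => ?_
    rw [hc, ← ih (B.erase a) b hc hb, Finset.mul_sum, Finset.mul_sum]
    refine Finset.sum_congr rfl fun l hl => ?_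
    rw [mem_lw] at hl
    have hbl : (b :: l).toFinset = B.erase a := by
      rw [List.toFinset_cons, hl.2, Finset.insert_erase hb]
    have hal : a ∉ b :: l := by rw [← List.mem_toFinset, hbl]; simp
    unfold W
    rw [two_pow_rl _ _ hal, occ_cons_cons, pow_add]
    have h1 : (∀ c ∈ b :: l, a < c) ↔ rk B a = 0 := by
      rw [← rk_zero, ← hbl]; simp only [List.mem_toFinset]
    have h2 : (l.filter (fun c => a < c ∧ c < b)).length = rk (B.erase a) b - rk B a := by
      rw [← rk_erase B a, ← rk_sub _ _ _ (by simp), ← List.toFinset_card_of_nodup (hl.1.filter _),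
        List.toFinset_filter, hl.2]
      congr 1
      ext x
      simp only [Finset.mem_filter, Finset.mem_erase, decide_eq_true_eq]
      constructor
      · rintro ⟨⟨_, h1⟩, h2⟩; exact ⟨h1, h2⟩
      · rintro ⟨h1, h2⟩; exact ⟨⟨by omega, h1⟩, h2⟩
    rw [h2]
    simp only [h1]
    ring

theorem hh_rec (M j : ℕ) (hj : j + 1 < M + 1) (hj0 : j ≠ 0) :
    X * hh (M + 2) (j + 2) = (1 + X) * hh (M + 2) (j + 1) - hh (M + 2) j
      - (1 - X) * hh (M + 1) (j + 1) := by
  have h : (1 - X) * hh (M + 1) (j + 1) =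
      ∑ i ∈ range (M + 1), (if i = j + 1 then (1 - X) * hh (M + 1) i else 0) := by
    rw [Finset.sum_ite_eq' (range (M + 1)) (j + 1) (fun i => (1 - X) * hh (M + 1) i)]
    rw [if_pos (by simpa using hj)]
  rw [h, hh, hh, hh, if_neg (by omega), if_neg (by omega), if_neg hj0, one_mul, one_mul, one_mul,
    Finset.mul_sum, Finset.mul_sum, ← Finset.sum_sub_distrib, ← Finset.sum_sub_distrib]
  refine Finset.sum_congr rfl fun i _ => ?_
  rcases lt_trichotomy i (j + 1) with h | h | h
  · rw [if_neg (by omega), show i - (j + 2) = 0 by omega, show i - (j + 1) = 0 by omega,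
      show i - j = 0 by omega]
    ring
  · subst h
    rw [if_pos rfl, show j + 1 - (j + 2) = 0 by omega, show j + 1 - (j + 1) = 0 by omega,
      show j + 1 - j = 1 by omega]
    ring
  · obtain ⟨t, rfl⟩ : ∃ t, i = j + 2 + t := ⟨i - (j + 2), by omega⟩
    rw [if_neg (by omega), show j + 2 + t - (j + 2) = t by omega,
      show j + 2 + t - (j + 1) = t + 1 by omega, show j + 2 + t - j = t + 2 by omega]
    ring

theorem periodic_mem {n : ℕ} (π : Equiv.Perm (Fin n)) (m : Fin n) :
    m ∈ Function.periodicPts π :=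
  π.injective.mem_periodicPts m

theorem perm_pow_iter {n : ℕ} (π : Equiv.Perm (Fin n)) (k : ℕ) (m : Fin n) :
    (π ^ k) m = (π)^[k] m := by
  rw [Equiv.Perm.iterate_eq_pow]

theorem coe_cycleList {n : ℕ} (π : Equiv.Perm (Fin n)) (m : Fin n) :
    ((cycleList π m : List (Fin n)) : Cycle (Fin n)) = Function.periodicOrbit π m := by
  unfold cycleList Function.periodicOrbit
  simp only [perm_pow_iter]

theorem nodup_cycleList {n : ℕ} (π : Equiv.Perm (Fin n)) (m : Fin n) : (cycleList π m).Nodup := by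
  rw [← Cycle.nodup_coe_iff, coe_cycleList]
  exact Function.nodup_periodicOrbit

theorem mem_cycleList {n : ℕ} (π : Equiv.Perm (Fin n)) (m x : Fin n) :
    x ∈ cycleList π m ↔ π.SameCycle m x := by
  rw [← Cycle.mem_coe_iff, coe_cycleList, Function.mem_periodicOrbit_iff (periodic_mem π m)]
  constructor
  · rintro ⟨k, rfl⟩
    exact ⟨k, by rw [zpow_natCast, perm_pow_iter]⟩
  · intro h
    obtain ⟨k, hk⟩ := h.exists_nat_pow_eq
    exact ⟨k, by rw [← perm_pow_iter, hk]⟩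

theorem cycleList_cons {n : ℕ} (π : Equiv.Perm (Fin n)) (m : Fin n) :
    ∃ t, cycleList π m = m :: t := by
  have h := Function.minimalPeriod_pos_of_mem_periodicPts (periodic_mem π m)
  obtain ⟨p, hp⟩ : ∃ p, Function.minimalPeriod π m = p + 1 := ⟨_, (Nat.succ_pred h.ne').symm⟩
  unfold cycleList
  rw [hp, List.range_succ_eq_map]
  exact ⟨_, by rw [List.map_cons]; rfl⟩

/-- The set of cycle minima. -/
def minSet {n : ℕ} (π : Equiv.Perm (Fin n)) : Finset (Fin n) :=
  Finset.univ.filter (fun m : Fin n => ∀ k < n, m ≤ (π ^ k) m)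

theorem mem_minSet {n : ℕ} (π : Equiv.Perm (Fin n)) (m : Fin n) :
    m ∈ minSet π ↔ ∀ x, π.SameCycle m x → m ≤ x := by
  unfold minSet
  simp only [Finset.mem_filter, Finset.mem_univ, true_and]
  constructor
  · intro h x hx
    rw [← mem_cycleList] at hx
    unfold cycleList at hx
    rw [List.mem_map] at hx
    obtain ⟨k, hk, rfl⟩ := hx
    rw [List.mem_range] at hk
    apply h
    have : (cycleList π m).length ≤ Fintype.card (Fin n) := (nodup_cycleList π m).length_le_card
    simp [cycleList] at this
    omega
  · intro h k _
    exact h _ ⟨k, by rw [zpow_natCast]⟩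

theorem mem_cycleMins {n : ℕ} (π : Equiv.Perm (Fin n)) (m : Fin n) :
    m ∈ cycleMins π ↔ ∀ x, π.SameCycle m x → m ≤ x := by
  rw [← mem_minSet]
  exact Finset.mem_sort _

theorem cycleMins_sorted {n : ℕ} (π : Equiv.Perm (Fin n)) :
    (cycleMins π).Pairwise (· < ·) := by
  unfold cycleMins
  exact (Finset.sortedLT_sort _).pairwise

/-- The flattened word with letters in `Fin n`. -/
noncomputable def Fl {n : ℕ} (π : Equiv.Perm (Fin n)) : List (Fin n) :=
  ((cycleMins π).map (cycleList π)).flatten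

theorem mem_Fl {n : ℕ} (π : Equiv.Perm (Fin n)) (x : Fin n) : x ∈ Fl π := by
  unfold Fl
  rw [List.mem_flatten]
  classical
  set s : Finset (Fin n) := Finset.univ.filter (fun y => π.SameCycle x y) with hs
  have hne : s.Nonempty := ⟨x, by rw [hs, Finset.mem_filter]; exact ⟨Finset.mem_univ _, Equiv.Perm.SameCycle.refl _ _⟩⟩
  have hm : π.SameCycle x (s.min' hne) := by
    have := s.min'_mem hne
    exact (Finset.mem_filter.1 this).2
  refine ⟨cycleList π (s.min' hne), List.mem_map_of_mem ?_, ?_⟩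
  · rw [mem_cycleMins]
    intro y hy
    apply Finset.min'_le
    rw [hs, Finset.mem_filter]
    exact ⟨Finset.mem_univ _, hm.trans hy⟩
  · rw [mem_cycleList]; exact hm.symm

theorem min_unique {n : ℕ} (π : Equiv.Perm (Fin n)) (a b : Fin n) (ha : a ∈ cycleMins π)
    (hb : b ∈ cycleMins π) (h : π.SameCycle a b) : a = b := by
  rw [mem_cycleMins] at ha hb
  exact le_antisymm (ha _ h) (hb _ h.symm)

theorem nodup_Fl {n : ℕ} (π : Equiv.Perm (Fin n)) : (Fl π).Nodup := by
  unfold Fl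
  rw [List.nodup_flatten]
  constructor
  · intro l hl
    rw [List.mem_map] at hl
    obtain ⟨m, _, rfl⟩ := hl
    exact nodup_cycleList π m
  · rw [List.pairwise_map]
    refine List.Pairwise.imp_of_mem ?_ (cycleMins_sorted π)
    intro a b ha hb hab x hxa hxb
    rw [mem_cycleList] at hxa hxb
    exact hab.ne (min_unique π a b ha hb (hxa.trans hxb.symm))

theorem Fl_split {n : ℕ} (π : Equiv.Perm (Fin n)) (m : Fin n) (hm : m ∈ cycleMins π) :
    ∃ p s, Fl π = p ++ m :: s ∧ ∀ b ∈ s, m < b := by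
  obtain ⟨M1, M2, hM⟩ := List.append_of_mem hm
  obtain ⟨t, ht⟩ := cycleList_cons π m
  refine ⟨(M1.map (cycleList π)).flatten, t ++ (M2.map (cycleList π)).flatten, ?_, ?_⟩
  · unfold Fl
    rw [hM]
    simp [ht]
  · intro b hb
    rw [List.mem_append] at hb
    rcases hb with hb | hb
    · have h1 : π.SameCycle m b := by rw [← mem_cycleList, ht]; simp [hb]
      have h2 := (mem_cycleMins π m).1 hm b h1
      have h3 := nodup_cycleList π m
      rw [ht, List.nodup_cons] at h3
      exact lt_of_le_of_ne h2 (fun h => h3.1 (h ▸ hb))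
    · simp only [List.mem_flatten, List.mem_map] at hb
      obtain ⟨_, ⟨m', hm', rfl⟩, hb⟩ := hb
      rw [mem_cycleList] at hb
      have hs := cycleMins_sorted π
      have hm'' : m' ∈ cycleMins π := by rw [hM]; simp [hm']
      rw [hM, List.pairwise_append, List.pairwise_cons] at hs
      exact lt_of_lt_of_le (hs.2.1.1 m' hm') ((mem_cycleMins π m').1 hm'' b hb)

theorem cycleMins_zero {N : ℕ} (π : Equiv.Perm (Fin (N + 1))) : ∃ M, cycleMins π = 0 :: M := by
  have h0 : (0 : Fin (N + 1)) ∈ cycleMins π := by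
    rw [mem_cycleMins]; intro x _; exact Fin.zero_le x
  have hs := cycleMins_sorted π
  cases h : cycleMins π with
  | nil => rw [h] at h0; simp at h0
  | cons a M =>
    rw [h] at h0 hs
    rw [List.pairwise_cons] at hs
    rw [List.mem_cons] at h0
    rcases h0 with h0 | h0
    · exact ⟨M, by rw [h0]⟩
    · exact absurd (hs.1 0 h0) (by simp)

theorem Fl_zero {N : ℕ} (π : Equiv.Perm (Fin (N + 1))) : ∃ T, Fl π = 0 :: T := by
  obtain ⟨M, hM⟩ := cycleMins_zero π
  obtain ⟨t, ht⟩ := cycleList_cons π 0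
  unfold Fl
  rw [hM]
  exact ⟨t ++ (M.map (cycleList π)).flatten, by simp [ht]⟩

theorem append_inj_of_stop {α : Type*} (P : α → Prop) (t t' r r' : List α)
    (ht : ∀ x ∈ t, ¬ P x) (ht' : ∀ x ∈ t', ¬ P x)
    (hr : ∀ x y, r = x :: y → P x) (hr' : ∀ x y, r' = x :: y → P x)
    (h : t ++ r = t' ++ r') : t = t' ∧ r = r' := by
  induction t generalizing t' with
  | nil =>
    cases t' with
    | nil => exact ⟨rfl, by simpa using h⟩
    | cons a t' =>
      exact absurd (hr a (t' ++ r') (by simpa using h)) (ht' a (by simp))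
  | cons a t ih =>
    cases t' with
    | nil => exact absurd (hr' a (t ++ r) (by simpa using h.symm)) (ht a (by simp))
    | cons a' t' =>
      simp only [List.cons_append, List.cons.injEq] at h
      obtain ⟨rfl, h⟩ := h
      have := ih t' (fun x hx => ht x (by simp [hx])) (fun x hx => ht' x (by simp [hx])) h
      exact ⟨by rw [this.1], this.2⟩

theorem flatten_inj {α : Type*} (P : α → Prop) (c c' : α → List α) (M : List α)
    (hM : ∀ m ∈ M, P m)
    (hc : ∀ m ∈ M, ∃ t, c m = m :: t ∧ ∀ x ∈ t, ¬ P x)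
    (hc' : ∀ m ∈ M, ∃ t, c' m = m :: t ∧ ∀ x ∈ t, ¬ P x)
    (h : (M.map c).flatten = (M.map c').flatten) : ∀ m ∈ M, c m = c' m := by
  have key : ∀ (c : α → List α) (M : List α), (∀ m ∈ M, P m) →
      (∀ m ∈ M, ∃ t, c m = m :: t ∧ ∀ x ∈ t, ¬ P x) →
      ∀ x y, (M.map c).flatten = x :: y → P x := by
    intro c M hM hc x y hxy
    cases M with
    | nil => simp at hxy
    | cons m M =>
      obtain ⟨t, ht, _⟩ := hc m (by simp)
      simp [ht] at hxy
      exact hxy.1 ▸ hM m (by simp)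
  induction M with
  | nil => simp
  | cons m M ih =>
    obtain ⟨t, ht, htP⟩ := hc m (by simp)
    obtain ⟨t', ht', htP'⟩ := hc' m (by simp)
    have hM2 : ∀ m ∈ M, P m := fun x hx => hM x (by simp [hx])
    have hc2 : ∀ m ∈ M, ∃ t, c m = m :: t ∧ ∀ x ∈ t, ¬ P x := fun x hx => hc x (by simp [hx])
    have hc2' : ∀ m ∈ M, ∃ t, c' m = m :: t ∧ ∀ x ∈ t, ¬ P x := fun x hx => hc' x (by simp [hx])
    rw [List.map_cons, List.map_cons, List.flatten_cons, List.flatten_cons, ht, ht',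
      List.cons_append, List.cons_append, List.cons.injEq] at h
    have := append_inj_of_stop P _ _ _ _ htP htP' (key c M hM2 hc2) (key c' M hM2 hc2') h.2
    intro x hx
    rw [List.mem_cons] at hx
    rcases hx with rfl | hx
    · rw [ht, ht', this.1]
    · exact ih hM2 hc2 hc2' this.2 x hx

theorem cycleList_tail {n : ℕ} (π : Equiv.Perm (Fin n)) (m : Fin n) (hm : m ∈ cycleMins π) :
    ∃ t, cycleList π m = m :: t ∧ ∀ x ∈ t, ¬ x ∈ cycleMins π := by
  obtain ⟨t, ht⟩ := cycleList_cons π m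
  refine ⟨t, ht, fun x hx hx' => ?_⟩
  have h1 : π.SameCycle m x := by rw [← mem_cycleList, ht]; simp [hx]
  have h3 := nodup_cycleList π m
  rw [ht, List.nodup_cons] at h3
  have := min_unique π m x hm hx' h1
  subst this
  exact h3.1 hx

/-- A permutation acts on a cycle list as the rotation of that list. -/
theorem cycleList_apply {n : ℕ} (π σ : Equiv.Perm (Fin n)) (m : Fin n)
    (h : cycleList π m = cycleList σ m) (x : Fin n) (hx : x ∈ cycleList π m) : π x = σ x := by
  have hl : Function.minimalPeriod π m = Function.minimalPeriod σ m := by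
    have := congrArg List.length h
    simpa [cycleList] using this
  have hall : ∀ k < Function.minimalPeriod π m, (π ^ k) m = (σ ^ k) m := by
    intro k hk
    unfold cycleList at h
    rw [← hl] at h
    exact (List.map_inj_left.1 h) k (List.mem_range.2 hk)
  unfold cycleList at hx
  rw [List.mem_map] at hx
  obtain ⟨k, hk, rfl⟩ := hx
  rw [List.mem_range] at hk
  have e1 : π ((π ^ k) m) = (π ^ (k + 1)) m := by rw [pow_succ']; rfl
  have e2 : σ ((π ^ k) m) = (σ ^ (k + 1)) m := by rw [hall k hk, pow_succ']; rfl
  rw [e1, e2]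
  rcases lt_or_eq_of_le (Nat.succ_le_of_lt hk) with h1 | h1
  · exact hall _ h1
  · have h1 : k + 1 = Function.minimalPeriod π m := h1
    rw [perm_pow_iter, perm_pow_iter, h1, Function.iterate_minimalPeriod, hl,
      Function.iterate_minimalPeriod]

theorem perm_ext {n : ℕ} (π σ : Equiv.Perm (Fin n)) (h1 : cycleMins π = cycleMins σ)
    (h2 : Fl π = Fl σ) : π = σ := by
  have key : ∀ m ∈ cycleMins π, cycleList π m = cycleList σ m := by
    apply flatten_inj (· ∈ cycleMins π) _ _ _ (fun _ h => h) (cycleList_tail π)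
    · intro m hm
      have := cycleList_tail σ m (h1 ▸ hm)
      rw [← h1] at this
      exact this
    · unfold Fl at h2
      rw [← h1] at h2
      exact h2
  ext x
  have hx := mem_Fl π x
  unfold Fl at hx
  simp only [List.mem_flatten, List.mem_map] at hx
  obtain ⟨_, ⟨m, hm, rfl⟩, hx⟩ := hx
  rw [cycleList_apply π σ m (key m hm) x hx]

theorem flattenPerm_eq {n : ℕ} (π : Equiv.Perm (Fin n)) :
    flattenPerm π = (Fl π).map (fun m : Fin n => (m : ℕ) + 1) := by
  have h : ∀ l : List (Fin n), (l >>= fun a => pure (a : ℕ)) = l.map (fun a : Fin n => (a : ℕ)) := by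
    intro l
    induction l with
    | nil => rfl
    | cons a l ih =>
      simp only [List.bind_eq_flatMap, List.flatMap_cons, List.map_cons] at ih ⊢
      rw [ih]
      rfl
  unfold flattenPerm Fl
  rw [h, List.map_map]
  rfl

theorem val_succ_inj (n : ℕ) : Function.Injective (fun m : Fin n => (m : ℕ) + 1) := by
  intro a b h
  exact Fin.ext (by simpa using h)

/-- The word (without its first letter) and the marks attached to a permutation. -/
noncomputable def phi {N : ℕ} (π : Equiv.Perm (Fin (N + 1))) : Σ _ : List ℕ, Finset ℕ :=
  ⟨(flattenPerm π).tail, ((minSet π).erase 0).image (fun m : Fin (N + 1) => (m : ℕ) + 1)⟩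

theorem flattenPerm_tail {N : ℕ} (π : Equiv.Perm (Fin (N + 1))) :
    flattenPerm π = 1 :: (flattenPerm π).tail := by
  obtain ⟨T, hT⟩ := Fl_zero π
  rw [flattenPerm_eq, hT]
  simp

theorem phi_inj {N : ℕ} : Function.Injective (phi (N := N)) := by
  intro π σ h
  unfold phi at h
  simp only [Sigma.mk.injEq, heq_eq_eq] at h
  obtain ⟨h1, h2⟩ := h
  have h0 : ∀ π : Equiv.Perm (Fin (N + 1)), (0 : Fin (N + 1)) ∈ minSet π := by
    intro π; rw [mem_minSet]; intro x _; exact Fin.zero_le x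
  have h3 := Finset.image_injective (val_succ_inj (N + 1)) h2
  have h4 : minSet π = minSet σ := by
    rw [← Finset.insert_erase (h0 π), h3, Finset.insert_erase (h0 σ)]
  apply perm_ext
  · unfold cycleMins
    unfold minSet at h4
    rw [h4]
  · have : flattenPerm π = flattenPerm σ := by
      rw [flattenPerm_tail π, h1, ← flattenPerm_tail]
    rw [flattenPerm_eq, flattenPerm_eq] at this
    exact (List.map_injective_iff.2 (val_succ_inj (N + 1))) this

theorem phi_mem {N : ℕ} (π : Equiv.Perm (Fin (N + 1))) :
    phi π ∈ (lw (Finset.Icc 2 (N + 1))).sigma (fun u => (rl u).powerset) := by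
  unfold phi
  rw [Finset.mem_sigma]
  constructor
  · rw [mem_lw]
    have hn : (flattenPerm π).Nodup := by
      rw [flattenPerm_eq]; exact (nodup_Fl π).map (val_succ_inj _)
    have hn2 := hn
    rw [flattenPerm_tail π, List.nodup_cons] at hn2
    refine ⟨hn2.2, ?_⟩
    ext x
    rw [List.mem_toFinset, Finset.mem_Icc]
    constructor
    · intro hx
      have h1 : x ≠ 1 := by rintro rfl; exact hn2.1 hx
      have h2 : x ∈ flattenPerm π := List.mem_of_mem_tail hx
      rw [flattenPerm_eq, List.mem_map] at h2
      obtain ⟨m, _, rfl⟩ := h2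
      have := m.2
      omega
    · rintro ⟨h1, h2⟩
      have h3 : x ∈ flattenPerm π := by
        rw [flattenPerm_eq, List.mem_map]
        exact ⟨⟨x - 1, by omega⟩, mem_Fl _ _, by simp only; omega⟩
      rw [flattenPerm_tail π, List.mem_cons] at h3
      rcases h3 with h3 | h3
      · omega
      · exact h3
  · rw [Finset.mem_powerset]
    intro y hy
    rw [Finset.mem_image] at hy
    obtain ⟨m, hm, rfl⟩ := hy
    rw [Finset.mem_erase] at hm
    obtain ⟨p, s, hps, hs⟩ := Fl_split π m (by rw [mem_cycleMins, ← mem_minSet]; exact hm.2)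
    obtain ⟨T, hT⟩ := Fl_zero π
    cases p with
    | nil =>
      rw [hT] at hps
      simp only [List.nil_append, List.cons.injEq] at hps
      exact absurd hps.1.symm hm.1
    | cons a p =>
      simp only [flattenPerm_eq, hps, List.cons_append, List.map_cons, List.map_append,
        List.tail_cons]
      apply mem_rl
      intro b hb
      rw [List.mem_map] at hb
      obtain ⟨b, hb, rfl⟩ := hb
      have := hs b hb
      rw [Fin.lt_def] at this
      omega

theorem phi_image (N : ℕ) : (Finset.univ : Finset (Equiv.Perm (Fin (N + 1)))).image phi =
    (lw (Finset.Icc 2 (N + 1))).sigma (fun u => (rl u).powerset) := by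
  apply Finset.eq_of_subset_of_card_le
  · intro y hy
    rw [Finset.mem_image] at hy
    obtain ⟨π, _, rfl⟩ := hy
    exact phi_mem π
  · rw [Finset.card_image_of_injective _ phi_inj, Finset.card_sigma]
    simp only [Finset.card_powerset]
    rw [lw_count N _ (by simp), Finset.card_univ, Fintype.card_perm, Fintype.card_fin]

theorem sum_flatten (N : ℕ) (f : List ℕ → Polynomial ℤ) :
    ∑ π : Equiv.Perm (Fin (N + 1)), f (flattenPerm π) =
      ∑ u ∈ lw (Finset.Icc 2 (N + 1)), 2 ^ (rl u).card * f (1 :: u) := by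
  have h1 : ∑ π : Equiv.Perm (Fin (N + 1)), f (flattenPerm π) =
      ∑ π : Equiv.Perm (Fin (N + 1)), f (1 :: (phi π).1) := by
    refine Finset.sum_congr rfl fun π _ => ?_
    rw [flattenPerm_tail π]; rfl
  rw [h1, ← Finset.sum_image (f := fun p : (Σ _ : List ℕ, Finset ℕ) => f (1 :: p.1))
    (fun a _ b _ h => phi_inj h), phi_image, Finset.sum_sigma]
  refine Finset.sum_congr rfl fun u _ => ?_
  simp [Finset.card_powerset]

theorem gPrefix_eq (N k : ℕ) (hk : 2 ≤ k) (hkN : k ≤ N + 2) :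
    gPrefix (N + 2) [1, k] = X ^ (k - 2) * hh (N + 1) (k - 2) := by
  unfold gPrefix
  rw [Finset.sum_filter, sum_flatten (N + 1) (fun w => if [1, k] <+: w then X ^ occ w else 0),
    lw_sum _ (by simp)]
  have hkm : k ∈ Finset.Icc 2 (N + 2) := by simp [hk, hkN]
  rw [Finset.sum_eq_single_of_mem k hkm]
  · have hr : rk (Finset.Icc 2 (N + 2)) k = k - 2 := by
      unfold rk
      have : (Finset.Icc 2 (N + 2)).filter (· < k) = Finset.Ico 2 k := by
        ext x; simp only [Finset.mem_filter, Finset.mem_Icc, Finset.mem_Ico]; omega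
      rw [this, Nat.card_Ico]
    have := sum_W N (Finset.Icc 2 (N + 2)) k (by simp) hkm
    rw [hr] at this
    rw [← this, Finset.mul_sum]
    refine Finset.sum_congr rfl fun l hl => ?_
    rw [mem_lw] at hl
    rw [if_pos (by simp), occ_cons_cons]
    have h2 : (l.filter (fun c => 1 < c ∧ c < k)).length = k - 2 := by
      rw [← List.toFinset_card_of_nodup (hl.1.filter _), List.toFinset_filter, hl.2]
      rw [← Nat.card_Ico]
      congr 1
      ext x
      simp only [Finset.mem_filter, Finset.mem_erase, decide_eq_true_eq, Finset.mem_Icc,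
        Finset.mem_Ico]
      omega
    rw [h2, pow_add]
    unfold W
    ring
  · intro b _ hbk
    refine Finset.sum_eq_zero fun l _ => ?_
    rw [if_neg, mul_zero]
    simp
    exact fun h => hbk h.symm

/-- For `n ≥ 5` and `5 ≤ k ≤ n`,
`g_n(1k) = (1+q)·g_n(1(k-1)) − q·g_n(1(k-2)) − (1−q)·g_{n-1}(1(k-1))` in `ℤ[q]`. -/
theorem gPrefix_second_order_recurrence (n k : ℕ) (hn : 5 ≤ n) (hk : 5 ≤ k) (hkn : k ≤ n) :
    gPrefix n [1, k]
      = (1 + X) * gPrefix n [1, k - 1] - X * gPrefix n [1, k - 2]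
        - (1 - X) * gPrefix (n - 1) [1, k - 1] := by
  obtain ⟨N, rfl⟩ : ∃ N, n = N + 3 := ⟨n - 3, by omega⟩
  obtain ⟨j, rfl⟩ : ∃ j, k = j + 4 := ⟨k - 4, by omega⟩
  have e1 := gPrefix_eq (N + 1) (j + 4) (by omega) (by omega)
  have e2 := gPrefix_eq (N + 1) (j + 3) (by omega) (by omega)
  have e3 := gPrefix_eq (N + 1) (j + 2) (by omega) (by omega)
  have e4 := gPrefix_eq N (j + 3) (by omega) (by omega)
  have h := hh_rec N j (by omega) (by omega)
  simp only [show j + 4 - 2 = j + 2 by omega, show j + 3 - 2 = j + 1 by omega,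
    show j + 2 - 2 = j by omega, show N + 1 + 2 = N + 3 by omega,
    show N + 1 + 1 = N + 2 by omega] at e1 e2 e3 e4
  rw [show j + 4 - 1 = j + 3 by omega, show j + 4 - 2 = j + 2 by omega,
    show N + 3 - 1 = N + 2 by omega, e1, e2, e3, e4]
  linear_combination (X ^ (j + 1)) * h
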